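/- Fix n ≥ 1, an integer j with 0 ≤ j ≤ n−2, and an integer k with 1 ≤ k ≤ n−j. Let K be either the top-to-random-with-standardisation matrix K_n, in which case β = j/n, or the binomial-top-to-random-with-standardisation matrix K_n^q for some q ∈ [0,1], in which case β = q^{n−j}. Then for every t ≥ 0: ∑_{σ ∈ S_n : σ_{j+k} = min{σ_{j+1},…,σ_n}} K^t(id, σ) = (1/(n−j))·(1 + β^t·(n−j−1)) if k = 1, and = (1/(n−j))·(1 − β^t) if k ≥ 2, where K^t denotes the t-th matrix power and id the identity permutation. -/

import Mathlib

open scoped Classical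

noncomputable section

/-- The standardisation (rank function) of a word `w = (w 0, …, w (m-1))` of distinct
letters from a linear order: position `a` is sent to the number of positions carrying a
smaller letter (so, `0`-indexed ranks). -/
def std {m : ℕ} {α : Type*} [LinearOrder α] (w : Fin m → α) : Fin m → Fin m :=
  fun a =>
    ⟨(Finset.univ.filter (fun b => w b < w a)).card, by
      have ha : a ∉ Finset.univ.filter (fun b => w b < w a) := by simp
      have h := Finset.card_lt_card
        ((Finset.ssubset_iff_of_subset (Finset.filter_subset _ _)).2
          ⟨a, Finset.mem_univ a, ha⟩)
      simpa using h⟩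

/-- `subMatch n r σ τ` says: the subsequence of the word `(τ 0, …, τ (n-1))` consisting of
the entries with values `≥ r` (`0`-indexed; these are the values `{r+1,…,n}` in `1`-indexed
notation) has the same standardisation as the word `(σ r, …, σ (n-1))`.
Here `g` is the (unique) strictly increasing enumeration of the relevant positions. -/
def subMatch (n r : ℕ) (σ τ : Equiv.Perm (Fin n)) : Prop :=
  ∃ g : Fin (n - r) → Fin n, StrictMono g ∧
    (∀ p : Fin n, (∃ a, g a = p) ↔ r ≤ (τ p : ℕ)) ∧
    std (fun a => τ (g a)) =
      std (fun a : Fin (n - r) => σ ⟨r + (a : ℕ), by have := a.isLt; omega⟩)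

/-- The top-to-random-with-standardisation transition matrix on `S_n`. -/
def Ktr (n : ℕ) : Matrix (Equiv.Perm (Fin n)) (Equiv.Perm (Fin n)) ℝ :=
  Matrix.of fun σ τ => if subMatch n 1 σ τ then 1 / (n : ℝ) else 0

/-- The binomial-top-to-random-with-standardisation transition matrix on `S_n`,
with parameter `q`. -/
def Kq (n : ℕ) (q : ℝ) : Matrix (Equiv.Perm (Fin n)) (Equiv.Perm (Fin n)) ℝ :=
  Matrix.of fun σ τ =>
    ∑ r ∈ Finset.range (n + 1),
      ((1 - q) ^ r * q ^ (n - r) / (r.factorial : ℝ)) *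
        (if subMatch n r σ τ then 1 else 0)

/-- The word `(σ_{j+1}, …, σ_n)` (0-indexed: the entries of `σ` at positions `j,…,n-1`). -/
def tailWord (n j : ℕ) (σ : Equiv.Perm (Fin n)) : Fin (n - j) → Fin n :=
  fun a => σ ⟨j + (a : ℕ), by have := a.isLt; omega⟩

/-- The word `(j+1, τ_{j+1}, …, τ_{i-1}, τ_{i+1}, …, τ_n)` (0-indexed: first letter the
value `j`, followed by the entries of `τ` at positions `j,…,n-1` skipping position `i`). -/
def wMinus (n j : ℕ) (i : Fin n) (τ : Equiv.Perm (Fin n)) : Fin (n - j) → Fin n :=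
  fun a =>
    if (a : ℕ) = 0 then ⟨j, by have := a.isLt; omega⟩
    else if j + (a : ℕ) - 1 < (i : ℕ) then τ ⟨j + (a : ℕ) - 1, by have := a.isLt; omega⟩
    else τ ⟨j + (a : ℕ), by have := a.isLt; omega⟩

/-- The eigenfunction `f_τ` attached to a non-identity permutation `τ`, where `j` is the
number of initial fixed points of `τ` and `i` is the position of the value `j` in `τ`. -/
def fTau (n j : ℕ) (i : Fin n) (τ σ : Equiv.Perm (Fin n)) : ℝ :=
  if std (tailWord n j σ) = std (tailWord n j τ) then 1
  else if std (tailWord n j σ) = std (wMinus n j i τ) then -1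
  else 0


theorem std_lt_std_iff {m : ℕ} {α : Type*} [LinearOrder α] (w : Fin m → α) (a b : Fin m) :
    std w a < std w b ↔ w a < w b := by
  have hmono : ∀ {c d : Fin m}, w c ≤ w d → std w c ≤ std w d := fun {c d} h =>
    Fin.mk_le_mk.2 (Finset.card_le_card fun e => by
      simpa using fun he : w e < w c => he.trans_le h)
  refine ⟨fun h => lt_of_not_ge fun h' => (hmono h').not_gt h, fun h => Fin.mk_lt_mk.2 ?_⟩
  refine Finset.card_lt_card ((Finset.ssubset_iff_of_subset fun e => ?_).2 ⟨a, ?_, ?_⟩)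
  · simpa using fun he : w e < w a => he.trans h
  · simpa using h
  · simp

theorem std_eq_std_iff {m : ℕ} {α β : Type*} [LinearOrder α] [LinearOrder β]
    (w : Fin m → α) (v : Fin m → β) :
    std w = std v ↔ ∀ a b, w a < w b ↔ v a < v b := by
  refine ⟨fun h a b => by rw [← std_lt_std_iff w, h, std_lt_std_iff], fun h => funext fun a => ?_⟩
  simp only [std, h]

theorem std_injective {m : ℕ} {α : Type*} [LinearOrder α] {w : Fin m → α}
    (hw : Function.Injective w) : Function.Injective (std w) := by
  intro a b h
  have h₁ := std_lt_std_iff w a b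
  have h₂ := std_lt_std_iff w b a
  simp only [h, lt_irrefl, false_iff, not_lt] at h₁ h₂
  exact hw (le_antisymm h₂ h₁)

/-- The positions of the values below `r` in a permutation. -/
def smallPositions {n r : ℕ} (hr : r ≤ n) (τ : Equiv.Perm (Fin n)) : Fin r ↪ Fin n :=
  (Fin.castLEEmb hr).trans τ.symm.toEmbedding

theorem apply_smallPositions {n r : ℕ} (hr : r ≤ n) (τ : Equiv.Perm (Fin n)) (i : Fin r) :
    τ (smallPositions hr τ i) = Fin.castLE hr i := by
  simp [smallPositions]

theorem eq_smallPositions {n r : ℕ} (hr : r ≤ n) (τ : Equiv.Perm (Fin n)) {p : Fin n}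
    (hp : (τ p : ℕ) < r) : p = smallPositions hr τ ⟨τ p, hp⟩ := by
  apply τ.injective
  rw [apply_smallPositions]
  rfl

theorem subMatch_unique {n r : ℕ} (hr : r ≤ n) {σ τ₁ τ₂ : Equiv.Perm (Fin n)}
    (h₁ : subMatch n r σ τ₁) (h₂ : subMatch n r σ τ₂)
    (h : smallPositions hr τ₁ = smallPositions hr τ₂) : τ₁ = τ₂ := by
  obtain ⟨g₁, hg₁, hrange₁, hstd₁⟩ := h₁
  obtain ⟨g₂, hg₂, hrange₂, hstd₂⟩ := h₂
  have hsmall : ∀ p, (τ₂ p : ℕ) < r → τ₁ p = τ₂ p := by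
    intro p hp
    have h₃ := apply_smallPositions hr τ₁ ⟨τ₂ p, hp⟩
    rw [h, ← eq_smallPositions hr τ₂ hp] at h₃
    exact h₃
  have hsmall' : ∀ p, (τ₁ p : ℕ) < r → τ₁ p = τ₂ p := by
    intro p hp
    have h₃ := apply_smallPositions hr τ₂ ⟨τ₁ p, hp⟩
    rw [← h, ← eq_smallPositions hr τ₁ hp] at h₃
    exact h₃.symm
  have hlarge : ∀ p, r ≤ (τ₁ p : ℕ) ↔ r ≤ (τ₂ p : ℕ) := by
    intro p
    constructor
    · intro hp
      by_contra hlt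
      rw [hsmall p (not_le.1 hlt)] at hp
      exact hlt hp
    · intro hp
      by_contra hlt
      rw [← hsmall' p (not_le.1 hlt)] at hp
      exact hlt hp
  have hg : g₁ = g₂ := by
    refine (hg₁.range_inj hg₂).1 (Set.ext fun p => ?_)
    exact (hrange₁ p).trans ((hlarge p).trans (hrange₂ p).symm)
  subst hg
  have horder := (std_eq_std_iff _ _).1 (hstd₁.trans hstd₂.symm)
  have hmono : StrictMono (τ₂.symm.trans τ₁) := by
    intro x y hxy
    obtain ⟨p, rfl⟩ := τ₂.surjective x
    obtain ⟨s, rfl⟩ := τ₂.surjective y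
    simp only [Equiv.trans_apply, Equiv.symm_apply_apply]
    by_cases hs : (τ₂ s : ℕ) < r
    · rwa [hsmall s hs, hsmall p (lt_trans hxy hs)]
    · by_cases hp : (τ₂ p : ℕ) < r
      · rw [hsmall p hp]
        exact Fin.lt_def.2 (lt_of_lt_of_le hp ((hlarge s).2 (not_lt.1 hs)))
      · obtain ⟨a, rfl⟩ := (hrange₂ p).2 (not_lt.1 hp)
        obtain ⟨b, rfl⟩ := (hrange₂ s).2 (not_lt.1 hs)
        exact (horder a b).2 hxy
  have hid : ⇑(τ₂.symm.trans τ₁) = id :=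
    (hmono.range_inj strictMono_id).1 (by rw [Equiv.range_eq_univ, Set.range_id])
  ext p
  have := congrFun hid (τ₂ p)
  simp only [Equiv.trans_apply, Equiv.symm_apply_apply, id] at this
  rw [this]

theorem exists_subMatch {n r : ℕ} (hr : r ≤ n) (σ : Equiv.Perm (Fin n)) (e : Fin r ↪ Fin n) :
    ∃ τ, subMatch n r σ τ ∧ smallPositions hr τ = e := by
  set S : Finset (Fin n) := (Finset.univ.map e)ᶜ with hS
  have hcard : S.card = n - r := by
    rw [hS, Finset.card_compl, Finset.card_map, Finset.card_univ, Fintype.card_fin,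
      Fintype.card_fin]
  have hnr : r + (n - r) = n := Nat.add_sub_of_le hr
  set g := S.orderEmbOfFin hcard with hgdef
  have hgS : ∀ a i, e i ≠ g a := by
    intro a i hi
    have := S.orderEmbOfFin_mem hcard a
    rw [← hgdef, ← hi, hS] at this
    simp at this
  set v := std (tailWord n r σ) with hv
  have hvinj : Function.Injective v := by
    refine std_injective fun a b hab => ?_
    have := σ.injective hab
    simp only [Fin.mk.injEq] at this
    exact Fin.ext (by omega)
  have hpos : Function.Bijective (Sum.elim e g : Fin r ⊕ Fin (n - r) → Fin n) := by
    refine (Fintype.bijective_iff_injective_and_card _).2 ⟨?_, by simp [hnr]⟩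
    exact e.injective.sumElim g.injective fun i a => hgS a i
  have hval : Function.Bijective (Sum.elim (Fin.castLE hr)
      (fun a => ⟨r + v a, by omega⟩) : Fin r ⊕ Fin (n - r) → Fin n) := by
    refine (Fintype.bijective_iff_injective_and_card _).2 ⟨?_, by simp [hnr]⟩
    refine (Fin.castLE_injective hr).sumElim (fun a b hab => ?_) fun i a h => ?_
    · simp only [Fin.mk.injEq] at hab
      exact hvinj (Fin.ext (by omega))
    · have := congrArg Fin.val h
      simp only [Fin.val_castLE] at this
      omega
  set τ : Equiv.Perm (Fin n) :=
    (Equiv.ofBijective _ hpos).symm.trans (Equiv.ofBijective _ hval) with hτ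
  have hτe : ∀ i, τ (e i) = Fin.castLE hr i := by
    intro i
    have : (Equiv.ofBijective _ hpos).symm (e i) = Sum.inl i :=
      (Equiv.symm_apply_eq _).2 rfl
    rw [hτ, Equiv.trans_apply, this]
    rfl
  have hτg : ∀ a, τ (g a) = ⟨r + v a, by omega⟩ := by
    intro a
    have : (Equiv.ofBijective _ hpos).symm (g a) = Sum.inr a :=
      (Equiv.symm_apply_eq _).2 rfl
    rw [hτ, Equiv.trans_apply, this]
    rfl
  refine ⟨τ, ⟨g, g.strictMono, fun p => ?_, ?_⟩, ?_⟩
  · obtain ⟨i | a, rfl⟩ := hpos.2 p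
    · simp only [Sum.elim_inl, hτe, Fin.val_castLE, (not_le.2 i.isLt), iff_false]
      rintro ⟨a, ha⟩
      exact hgS a i ha.symm
    · simp [hτg]
  · refine (std_eq_std_iff _ _).2 fun a b => ?_
    rw [hτg, hτg, Fin.mk_lt_mk, Nat.add_lt_add_iff_left]
    exact std_lt_std_iff (tailWord n r σ) a b
  · ext i : 1
    apply τ.injective
    rw [apply_smallPositions, hτe]

theorem StrictMono.fin_apply_le {n r : ℕ} {g : Fin (n - r) → Fin n} (hg : StrictMono g)
    (b : Fin (n - r)) : (g b : ℕ) ≤ r + b := by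
  have key : ∀ d : ℕ, ∀ b : Fin (n - r), (b : ℕ) + d + 1 = n - r → (g b : ℕ) + d + 1 ≤ n := by
    intro d
    induction d with
    | zero => intro b _; omega
    | succ d ih =>
      intro b hb
      have h₁ := ih ⟨b + 1, by omega⟩ (by simp only; omega)
      have h₂ : g b < g ⟨b + 1, by omega⟩ := hg (Fin.lt_def.2 (Nat.lt_succ_self _))
      omega
  have := key (n - r - 1 - b) b (by omega)
  omega

theorem exists_eq_add_of_strictMono {n r j : ℕ} {g : Fin (n - r) → Fin n} (hg : StrictMono g)
    (hj : ∀ p : Fin n, j ≤ (p : ℕ) → ∃ a, g a = p) :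
    ∀ p : Fin n, j ≤ (p : ℕ) → ∃ a, g a = p ∧ r + (a : ℕ) = p := by
  have key : ∀ d : ℕ, ∀ p : Fin n, n - (p : ℕ) ≤ d → j ≤ (p : ℕ) →
      ∃ a, g a = p ∧ r + (a : ℕ) = p := by
    intro d
    induction d with
    | zero => intro p hp; omega
    | succ d ih =>
      intro p hp hjp
      obtain ⟨a, rfl⟩ := hj p hjp
      have hle := hg.fin_apply_le a
      refine ⟨a, rfl, ?_⟩
      by_contra hne
      obtain ⟨c, hc, hca⟩ := ih ⟨r + a, by omega⟩ (by simp only; omega) (by simp only; omega)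
      have hcaeq : c = a := Fin.ext (by simpa using hca)
      rw [hcaeq] at hc
      exact hne (congrArg Fin.val hc).symm
  exact fun p => key _ p le_rfl

/-- The entry of `σ` at position `x` is the least among those at positions `j, …, n-1`. -/
def IsTailMin {n : ℕ} (j : ℕ) (x : Fin n) (σ : Equiv.Perm (Fin n)) : Prop :=
  ∀ m : Fin n, j ≤ (m : ℕ) → σ x ≤ σ m

/-- `x` is the first term of the sequence `e` that is at least `j`. -/
def IsFirstHit {n r : ℕ} (j : ℕ) (x : Fin n) (e : Fin r ↪ Fin n) : Prop :=
  ∃ i, e i = x ∧ ∀ i', j ≤ (e i' : ℕ) → i ≤ i'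

theorem isTailMin_iff_of_subMatch {n r j : ℕ} (hr : r ≤ n) {σ τ : Equiv.Perm (Fin n)}
    (h : subMatch n r σ τ) {x : Fin n} (hx : j ≤ (x : ℕ)) :
    IsTailMin j x τ ↔ IsFirstHit j x (smallPositions hr τ) ∨
      ((∀ i, (smallPositions hr τ i : ℕ) < j) ∧ IsTailMin j x σ) := by
  by_cases hhit : ∀ i, (smallPositions hr τ i : ℕ) < j
  · have hno : ¬ IsFirstHit j x (smallPositions hr τ) := by
      rintro ⟨i, rfl, -⟩
      exact (hhit i).not_ge hx
    simp only [hno, hhit, implies_true, true_and, false_or]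
    obtain ⟨g, hg, hrange, hstd⟩ := h
    have hshift := exists_eq_add_of_strictMono hg (j := j) fun p hp => by
      rw [hrange]
      by_contra hlt
      have h₁ := hhit ⟨τ p, not_le.1 hlt⟩
      rw [← eq_smallPositions hr τ] at h₁
      omega
    have horder := (std_eq_std_iff _ _).1 hstd
    obtain ⟨a, hax, hra⟩ := hshift x hx
    refine forall₂_congr fun m hm => ?_
    obtain ⟨b, hbm, hrb⟩ := hshift m hm
    have := horder b a
    simp only [hax, hbm, hra, hrb, Fin.eta] at this
    rw [← not_lt, this, not_lt]
  · simp only [hhit, false_and, or_false]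
    push Not at hhit
    obtain ⟨i₀, hi₀⟩ := hhit
    constructor
    · intro hmin
      have hxr : (τ x : ℕ) < r := by
        have := hmin _ hi₀
        rw [apply_smallPositions] at this
        exact lt_of_le_of_lt (Fin.le_def.1 this) i₀.isLt
      refine ⟨⟨τ x, hxr⟩, (eq_smallPositions hr τ hxr).symm, fun i' hi' => ?_⟩
      have := hmin _ hi'
      rw [apply_smallPositions] at this
      exact this
    · rintro ⟨i, rfl, hi⟩ m hm
      rw [apply_smallPositions, Fin.le_def, Fin.val_castLE]
      by_cases hmr : (τ m : ℕ) < r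
      · exact hi ⟨τ m, hmr⟩ (by rwa [← eq_smallPositions hr τ hmr])
      · omega

theorem card_isFirstHit_eq {n r j : ℕ} {x y : Fin n} (hx : j ≤ (x : ℕ)) (hy : j ≤ (y : ℕ)) :
    (Finset.univ.filter (fun e : Fin r ↪ Fin n => IsFirstHit j x e)).card =
      (Finset.univ.filter (fun e : Fin r ↪ Fin n => IsFirstHit j y e)).card := by
  have hswap : ∀ z : Fin n, j ≤ (Equiv.swap x y z : ℕ) ↔ j ≤ (z : ℕ) := by
    intro z
    rw [Equiv.swap_apply_def]
    split_ifs with h₁ h₂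
    · simp [h₁, hx, hy]
    · simp [h₂, hx, hy]
    · rfl
  refine Finset.card_equiv ((Equiv.refl _).embeddingCongr (Equiv.swap x y)) fun e => ?_
  rw [Finset.mem_filter, Finset.mem_filter]
  simp [IsFirstHit, Equiv.embeddingCongr, Function.Embedding.congr, hswap, Equiv.swap_apply_eq_iff]

theorem card_embedding_lt {n r j : ℕ} (hj : j ≤ n) :
    (Finset.univ.filter (fun e : Fin r ↪ Fin n => ∀ i, (e i : ℕ) < j)).card =
      j.descFactorial r := by
  have : j.descFactorial r = (Finset.univ : Finset (Fin r ↪ Fin j)).card := by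
    rw [Finset.card_univ, Fintype.card_embedding_eq, Fintype.card_fin, Fintype.card_fin]
  rw [this]
  symm
  refine Finset.card_bij (fun e _ => e.trans (Fin.castLEEmb hj)) ?_ ?_ ?_
  · simp
  · intro e₁ _ e₂ _ h
    ext i
    simpa using congrArg Fin.val (DFunLike.congr_fun h i)
  · intro e he
    simp only [Finset.mem_filter, Finset.mem_univ, true_and] at he
    refine ⟨⟨fun i => ⟨e i, he i⟩, fun a b hab => e.injective (Fin.ext ?_)⟩,
      Finset.mem_univ _, ?_⟩
    · simpa using hab
    · ext i
      rfl

theorem sum_card_isFirstHit {n r j : ℕ} (hj : j ≤ n) :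
    (∑ x ∈ Finset.univ.filter (fun x : Fin n => j ≤ (x : ℕ)),
      (Finset.univ.filter (fun e : Fin r ↪ Fin n => IsFirstHit j x e)).card) +
      j.descFactorial r = n.descFactorial r := by
  rw [← card_embedding_lt hj, ← Finset.card_biUnion, ← Finset.card_union_of_disjoint]
  · have : n.descFactorial r = (Finset.univ : Finset (Fin r ↪ Fin n)).card := by
      rw [Finset.card_univ, Fintype.card_embedding_eq, Fintype.card_fin, Fintype.card_fin]
    rw [this]
    congr 1
    refine Finset.eq_univ_iff_forall.2 fun e => ?_
    simp only [Finset.mem_union, Finset.mem_biUnion, Finset.mem_filter, Finset.mem_univ, true_and]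
    by_cases h : ∀ i, (e i : ℕ) < j
    · exact Or.inr h
    · push Not at h
      left
      refine ⟨e (Fin.find _ h), Fin.find_spec h, Fin.find _ h, rfl, fun i' hi' => ?_⟩
      exact Fin.find_le_of_pos h hi'
  · refine Finset.disjoint_left.2 fun e he he' => ?_
    simp only [Finset.mem_biUnion, Finset.mem_filter, Finset.mem_univ, true_and] at he he'
    obtain ⟨x, hx, i, rfl, -⟩ := he
    exact (he' i).not_ge hx
  · intro x hx y hy hxy
    refine Finset.disjoint_left.2 fun e he he' => hxy ?_
    simp only [Finset.mem_coe, Finset.mem_filter, Finset.mem_univ, true_and] at hx hy he he'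
    obtain ⟨i, rfl, hi⟩ := he
    obtain ⟨i', rfl, hi'⟩ := he'
    rw [le_antisymm (hi i' hy) (hi' i hx)]

theorem card_filter_le_val {n j : ℕ} :
    (Finset.univ.filter (fun x : Fin n => j ≤ (x : ℕ))).card = n - j := by
  have h := Fin.card_filter_val_lt (n := n) (m := j)
  have h' := Finset.card_filter_add_card_filter_not (s := (Finset.univ : Finset (Fin n)))
    (fun x : Fin n => (x : ℕ) < j)
  simp only [not_lt, Finset.card_univ, Fintype.card_fin] at h'
  omega

theorem card_isFirstHit {n r j : ℕ} {x : Fin n} (hx : j ≤ (x : ℕ)) :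
    (n - j) * (Finset.univ.filter (fun e : Fin r ↪ Fin n => IsFirstHit j x e)).card +
      j.descFactorial r = n.descFactorial r := by
  rw [← sum_card_isFirstHit (n := n) (by omega : j ≤ n), Finset.sum_congr rfl fun y hy =>
    card_isFirstHit_eq (y := x) (Finset.mem_filter.1 hy).2 hx, Finset.sum_const,
    card_filter_le_val, smul_eq_mul]

theorem card_subMatch_isTailMin {n r j : ℕ} (hr : r ≤ n) (σ : Equiv.Perm (Fin n)) {x : Fin n}
    (hx : j ≤ (x : ℕ)) :
    (Finset.univ.filter (fun τ => IsTailMin j x τ ∧ subMatch n r σ τ)).card =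
      (Finset.univ.filter (fun e : Fin r ↪ Fin n => IsFirstHit j x e)).card +
        if IsTailMin j x σ then j.descFactorial r else 0 := by
  have hbij : (Finset.univ.filter (fun τ => IsTailMin j x τ ∧ subMatch n r σ τ)).card =
      (Finset.univ.filter (fun e : Fin r ↪ Fin n =>
        IsFirstHit j x e ∨ ((∀ i, (e i : ℕ) < j) ∧ IsTailMin j x σ))).card := by
    refine Finset.card_bij (fun τ _ => smallPositions hr τ) ?_ ?_ ?_
    · intro τ hτ
      simp only [Finset.mem_filter, Finset.mem_univ, true_and] at hτ ⊢
      exact (isTailMin_iff_of_subMatch hr hτ.2 hx).1 hτ.1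
    · intro τ₁ h₁ τ₂ h₂ h
      simp only [Finset.mem_filter, Finset.mem_univ, true_and] at h₁ h₂
      exact subMatch_unique hr h₁.2 h₂.2 h
    · intro e he
      simp only [Finset.mem_filter, Finset.mem_univ, true_and] at he
      obtain ⟨τ, hτ, rfl⟩ := exists_subMatch hr σ e
      refine ⟨τ, ?_, rfl⟩
      simp only [Finset.mem_filter, Finset.mem_univ, true_and]
      exact ⟨(isTailMin_iff_of_subMatch hr hτ hx).2 he, hτ⟩
  rw [hbij]
  split_ifs with h
  · rw [← card_embedding_lt (n := n) (r := r) (by omega : j ≤ n),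
      ← Finset.card_union_of_disjoint, ← Finset.filter_or]
    · simp [h]
    · refine Finset.disjoint_left.2 fun e he he' => ?_
      simp only [Finset.mem_filter, Finset.mem_univ, true_and] at he he'
      obtain ⟨i, rfl, -⟩ := he
      exact (he' i).not_ge hx
  · simp [h]

theorem sum_subMatch_isTailMin {n r j : ℕ} (hr : r ≤ n) (σ : Equiv.Perm (Fin n)) {x : Fin n}
    (hx : j ≤ (x : ℕ)) :
    ∑ τ with IsTailMin j x τ, (if subMatch n r σ τ then (1 : ℝ) else 0) =
      ((n.descFactorial r : ℝ) - j.descFactorial r) / ((n : ℝ) - j) +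
        j.descFactorial r * if IsTailMin j x σ then 1 else 0 := by
  have hjn : j < n := by omega
  have hpos : (0 : ℝ) < (n : ℝ) - j := sub_pos.2 (Nat.cast_lt.2 hjn)
  have hcard := card_isFirstHit (r := r) hx
  rify [hjn.le] at hcard
  rw [Finset.sum_boole, Finset.filter_filter, card_subMatch_isTailMin hr σ hx, ← hcard]
  push_cast
  field_simp
  split_ifs <;> ring

theorem exists_isTailMin {n j : ℕ} (hj : j < n) (σ : Equiv.Perm (Fin n)) :
    ∃ x : Fin n, j ≤ (x : ℕ) ∧ IsTailMin j x σ := by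
  obtain ⟨x, hx, hmin⟩ := (Finset.univ.filter (fun x : Fin n => j ≤ (x : ℕ))).exists_min_image σ
    ⟨⟨j, hj⟩, by simp⟩
  simp only [Finset.mem_filter, Finset.mem_univ, true_and] at hx hmin
  exact ⟨x, hx, hmin⟩

theorem sum_ite_isTailMin {n j : ℕ} (hj : j < n) (σ : Equiv.Perm (Fin n)) :
    ∑ x ∈ Finset.univ.filter (fun x : Fin n => j ≤ (x : ℕ)), (if IsTailMin j x σ then (1 : ℝ) else 0) = 1 := by
  obtain ⟨x, hx, hmin⟩ := exists_isTailMin hj σ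
  rw [Finset.sum_eq_single x, if_pos hmin]
  · intro y hy hyx
    simp only [Finset.mem_filter, Finset.mem_univ, true_and] at hy
    exact if_neg fun h => hyx (σ.injective (le_antisymm (h x hx) (hmin y hy)))
  · simp [hx]

/-- If one step of the chain moves the tail minimum to a uniform position with probability `1 - β`
and leaves it in place with probability `β`, then so do `t` steps with `β ^ t`. -/
theorem sum_pow_isTailMin {n j : ℕ} (hj : j < n)
    (K : Matrix (Equiv.Perm (Fin n)) (Equiv.Perm (Fin n)) ℝ) (β : ℝ)
    (hK : ∀ σ, ∀ x : Fin n, j ≤ (x : ℕ) → ∑ τ with IsTailMin j x τ, K σ τ =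
      (1 - β) / ((n : ℝ) - j) + β * if IsTailMin j x σ then 1 else 0)
    (t : ℕ) (σ : Equiv.Perm (Fin n)) (x : Fin n) (hx : j ≤ (x : ℕ)) :
    ∑ τ with IsTailMin j x τ, (K ^ t) σ τ =
      (1 - β ^ t) / ((n : ℝ) - j) + β ^ t * if IsTailMin j x σ then 1 else 0 := by
  have hpos : (0 : ℝ) < (n : ℝ) - j := sub_pos.2 (Nat.cast_lt.2 hj)
  have hrow : ∀ ρ, ∑ τ, K ρ τ = 1 := by
    intro ρ
    have h₁ : ∀ τ, K ρ τ = ∑ x ∈ Finset.univ.filter (fun x : Fin n => j ≤ (x : ℕ)),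
        if IsTailMin j x τ then K ρ τ else 0 := by
      intro τ
      have h₂ := congrArg (K ρ τ * ·) (sum_ite_isTailMin hj τ)
      simp only [Finset.mul_sum, mul_ite, mul_one, mul_zero] at h₂
      exact h₂.symm
    rw [Finset.sum_congr rfl fun τ _ => h₁ τ, Finset.sum_comm]
    simp_rw [← Finset.sum_filter (s := (Finset.univ : Finset (Equiv.Perm (Fin n))))]
    rw [Finset.sum_congr rfl fun y hy => hK ρ y (Finset.mem_filter.1 hy).2,
      Finset.sum_add_distrib, ← Finset.mul_sum, sum_ite_isTailMin hj, Finset.sum_const,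
      card_filter_le_val, nsmul_eq_mul, Nat.cast_sub hj.le]
    field_simp
    ring
  induction t generalizing σ with
  | zero => simp [Matrix.one_apply]
  | succ t ih =>
    simp_rw [pow_succ', Matrix.mul_apply]
    rw [Finset.sum_comm]
    simp_rw [← Finset.mul_sum, ih, mul_add]
    rw [Finset.sum_add_distrib, ← Finset.sum_mul, hrow]
    have h₂ : ∑ ρ, K σ ρ * (β ^ t * if IsTailMin j x ρ then 1 else 0) =
        β ^ t * ∑ ρ with IsTailMin j x ρ, K σ ρ := by
      rw [Finset.sum_filter, Finset.mul_sum]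
      refine Finset.sum_congr rfl fun ρ _ => ?_
      split_ifs <;> ring
    rw [h₂, hK σ x hx]
    field_simp
    ring

theorem sum_Ktr_isTailMin {n j : ℕ} (σ : Equiv.Perm (Fin n)) {x : Fin n} (hx : j ≤ (x : ℕ)) :
    ∑ τ with IsTailMin j x τ, Ktr n σ τ =
      (1 - (j : ℝ) / n) / ((n : ℝ) - j) + (j : ℝ) / n * if IsTailMin j x σ then 1 else 0 := by
  have hn : 1 ≤ n := by omega
  have hn₀ : (n : ℝ) ≠ 0 := by positivity
  have hpos : (0 : ℝ) < (n : ℝ) - j := sub_pos.2 (Nat.cast_lt.2 (by omega))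
  have h : ∀ τ, Ktr n σ τ = 1 / (n : ℝ) * if subMatch n 1 σ τ then 1 else 0 := by
    intro τ
    simp [Ktr]
  simp_rw [h, ← Finset.mul_sum]
  rw [sum_subMatch_isTailMin hn σ hx, Nat.descFactorial_one, Nat.descFactorial_one]
  field_simp

theorem sum_binomial_descFactorial {n j : ℕ} (hj : j ≤ n) (q : ℝ) :
    ∑ r ∈ Finset.range (n + 1),
      (1 - q) ^ r * q ^ (n - r) / (r.factorial : ℝ) * j.descFactorial r = q ^ (n - j) := by
  have hterm : ∀ r, (1 - q) ^ r * q ^ (n - r) / (r.factorial : ℝ) * j.descFactorial r =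
      (1 - q) ^ r * q ^ (n - r) * j.choose r := by
    intro r
    have : (r.factorial : ℝ) ≠ 0 := Nat.cast_ne_zero.2 r.factorial_ne_zero
    rw [Nat.descFactorial_eq_factorial_mul_choose]
    push_cast
    field_simp
  simp_rw [hterm]
  rw [← Finset.sum_subset (Finset.range_mono (Nat.succ_le_succ hj)) fun r _ hr => by
    rw [Nat.choose_eq_zero_of_lt (by simpa using hr), Nat.cast_zero, mul_zero]]
  have hbinom := add_pow (1 - q) q j
  rw [sub_add_cancel, one_pow] at hbinom
  conv_rhs => rw [← mul_one (q ^ (n - j)), hbinom, Finset.mul_sum]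
  refine Finset.sum_congr rfl fun r hr => ?_
  have : n - r = (n - j) + (j - r) := by
    have := Finset.mem_range.1 hr
    omega
  rw [this, pow_add]
  ring

theorem sum_Kq_isTailMin {n j : ℕ} (q : ℝ) (σ : Equiv.Perm (Fin n)) {x : Fin n}
    (hx : j ≤ (x : ℕ)) :
    ∑ τ with IsTailMin j x τ, Kq n q σ τ =
      (1 - q ^ (n - j)) / ((n : ℝ) - j) +
        q ^ (n - j) * if IsTailMin j x σ then 1 else 0 := by
  simp only [Kq, Matrix.of_apply]
  rw [Finset.sum_comm]
  simp_rw [← Finset.mul_sum]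
  rw [Finset.sum_congr rfl fun r hr => by
    rw [sum_subMatch_isTailMin (Nat.lt_succ_iff.1 (Finset.mem_range.1 hr)) σ hx, mul_add,
      ← mul_div_assoc, mul_sub, ← mul_assoc],
    Finset.sum_add_distrib, ← Finset.sum_mul, ← Finset.sum_div, Finset.sum_sub_distrib,
    sum_binomial_descFactorial le_rfl, sum_binomial_descFactorial (by omega), Nat.sub_self,
    pow_zero]

theorem sum_pow_one_isTailMin {n j k : ℕ} (hj : j < n) (hk : 1 ≤ k) (hkn : j + k - 1 < n)
    (K : Matrix (Equiv.Perm (Fin n)) (Equiv.Perm (Fin n)) ℝ) (β : ℝ)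
    (hK : ∀ σ, ∀ x : Fin n, j ≤ (x : ℕ) → ∑ τ with IsTailMin j x τ, K σ τ =
      (1 - β) / ((n : ℝ) - j) + β * if IsTailMin j x σ then 1 else 0) (t : ℕ) :
    ∑ σ with IsTailMin j ⟨j + k - 1, hkn⟩ σ, (K ^ t) 1 σ =
      if k = 1 then (1 / ((n : ℝ) - j)) * (1 + β ^ t * ((n : ℝ) - j - 1))
      else (1 / ((n : ℝ) - j)) * (1 - β ^ t) := by
  have hpos : (0 : ℝ) < (n : ℝ) - j := sub_pos.2 (Nat.cast_lt.2 hj)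
  have hone : IsTailMin j ⟨j + k - 1, hkn⟩ 1 ↔ k = 1 := by
    simp only [IsTailMin, Equiv.Perm.one_apply, Fin.le_def]
    refine ⟨fun h => ?_, fun h m hm => by omega⟩
    have := h ⟨j, hj⟩ le_rfl
    simp only at this
    omega
  rw [sum_pow_isTailMin hj K β hK t 1 _ (by simp only; omega)]
  simp only [hone]
  split_ifs
  · field_simp
    ring
  · ring

/-- **Distribution of the position of the newest item among the bottom `n-j`**, after `t`
steps of the top-to-random-with-standardisation chain (eigenvalue `j/n`) or the
binomial-top-to-random-with-standardisation chain (eigenvalue `q^(n-j)`), started at the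
identity.  The sum runs over all `σ ∈ S_n` whose entry in position `j+k` (1-indexed) is
the minimum of the entries in positions `j+1,…,n`. -/
theorem position_of_minimum_distribution (n : ℕ) (hn : 1 ≤ n) (j k : ℕ)
    (hj : j ≤ n - 2) (hk1 : 1 ≤ k) (hk2 : k ≤ n - j) (t : ℕ) :
    (∑ σ ∈ Finset.univ.filter (fun σ : Equiv.Perm (Fin n) =>
          ∀ m : Fin n, j ≤ (m : ℕ) → σ ⟨j + k - 1, by omega⟩ ≤ σ m),
        (Ktr n ^ t) 1 σ
      = if k = 1 then
          (1 / ((n : ℝ) - (j : ℝ))) * (1 + ((j : ℝ) / (n : ℝ)) ^ t * ((n : ℝ) - (j : ℝ) - 1))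
        else (1 / ((n : ℝ) - (j : ℝ))) * (1 - ((j : ℝ) / (n : ℝ)) ^ t)) ∧
    (∀ q : ℝ, 0 ≤ q → q ≤ 1 →
      ∑ σ ∈ Finset.univ.filter (fun σ : Equiv.Perm (Fin n) =>
          ∀ m : Fin n, j ≤ (m : ℕ) → σ ⟨j + k - 1, by omega⟩ ≤ σ m),
        (Kq n q ^ t) 1 σ
      = if k = 1 then
          (1 / ((n : ℝ) - (j : ℝ))) * (1 + (q ^ (n - j)) ^ t * ((n : ℝ) - (j : ℝ) - 1))
        else (1 / ((n : ℝ) - (j : ℝ))) * (1 - (q ^ (n - j)) ^ t)) := by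
  have hjn : j < n := by omega
  have hkn : j + k - 1 < n := by omega
  refine ⟨?_, fun q _ _ => ?_⟩
  · have h := sum_pow_one_isTailMin hjn hk1 hkn _ _ (fun σ _ hx => sum_Ktr_isTailMin σ hx) t
    unfold IsTailMin at h
    convert h
  · have h := sum_pow_one_isTailMin hjn hk1 hkn _ _ (fun σ _ hx => sum_Kq_isTailMin q σ hx) t
    unfold IsTailMin at h
    convert h

end
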